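/- arXiv:2003.06360 — 2 statements merged into one kernel-verified Lean document; each statement's English description precedes it below -/
import Mathlib

section
/- Let d ≥ 1 and let U : ℝ^d → [0,∞) be a C^∞ function that attains the value 0 at some point of ℝ^d. Then there exists a constant κ > 0 such that for every β ≥ 1, ∫_{ℝ^d} e^{−β U(x)} dx ≥ κ β^{−d} (the integral being taken in [0,∞]). -/
open MeasureTheory Filter Set
open scoped ENNReal NNReal

noncomputable section

/-- Euclidean space `ℝ^d`. -/
abbrev Euc (d : ℕ) := EuclideanSpace ℝ (Fin d)

/-- **Lemma.** If `U : ℝ^d → [0,∞)` is `C^∞` and attains the value `0`, then there is `κ > 0`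
such that for every `β ≥ 1`, `∫_{ℝ^d} e^{-β U(x)} dx ≥ κ β^{-d}`. -/
theorem gibbs_partition_lower_bound
    {d : ℕ} (hd : 1 ≤ d) (U : Euc d → ℝ) (hU : ContDiff ℝ (⊤ : ℕ∞) U)
    (hUnonneg : ∀ x, 0 ≤ U x) (hU0 : ∃ x, U x = 0) :
    ∃ κ : ℝ, 0 < κ ∧ ∀ β : ℝ, 1 ≤ β →
      ENNReal.ofReal (κ / β ^ d) ≤
        ∫⁻ x, ENNReal.ofReal (Real.exp (-β * U x))
          ∂(MeasureTheory.volume : MeasureTheory.Measure (Euc d)) := by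
  obtain ⟨x₀, hx₀⟩ := hU0
  obtain ⟨K, t, ht, hK⟩ :=
    ((hU.of_le (by simp)).contDiffAt (x := x₀)).exists_lipschitzOnWith
  obtain ⟨ρ, hρ, hρt⟩ := Metric.mem_nhds_iff.1 ht
  have hU_le : ∀ x ∈ Metric.ball x₀ ρ, U x ≤ K * dist x x₀ := fun x hx => by
    have h := hK.dist_le_mul x (hρt hx) x₀ (mem_of_mem_nhds ht)
    rwa [hx₀, Real.dist_eq, sub_zero, abs_of_nonneg (hUnonneg x)] at h
  set V := (volume : Measure (Euc d)) (Metric.ball 0 1)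
  have hV_top : V ≠ ∞ := measure_ball_lt_top.ne
  have hV_pos : 0 < V.toReal :=
    ENNReal.toReal_pos (Metric.measure_ball_pos volume _ one_pos).ne' hV_top
  refine ⟨Real.exp (-(K * ρ)) * (ρ ^ d * V.toReal), by positivity, fun β hβ => ?_⟩
  have hβ₀ : 0 < β := one_pos.trans_le hβ
  have hr : 0 < ρ / β := by positivity
  calc ENNReal.ofReal (Real.exp (-(K * ρ)) * (ρ ^ d * V.toReal) / β ^ d)
      = ENNReal.ofReal (Real.exp (-(K * ρ))) *
          (volume : Measure (Euc d)) (Metric.ball x₀ (ρ / β)) := by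
        rw [Measure.addHaar_ball_of_pos _ _ hr, finrank_euclideanSpace_fin,
          show (volume : Measure (Euc d)) (Metric.ball 0 1) = ENNReal.ofReal V.toReal from
            (ENNReal.ofReal_toReal hV_top).symm, ← ENNReal.ofReal_mul (by positivity),
          ← ENNReal.ofReal_mul (by positivity), div_pow]
        congr 1
        ring
    _ = ∫⁻ _ in Metric.ball x₀ (ρ / β), ENNReal.ofReal (Real.exp (-(K * ρ))) :=
        (setLIntegral_const _ _).symm
    _ ≤ ∫⁻ x in Metric.ball x₀ (ρ / β), ENNReal.ofReal (Real.exp (-β * U x)) := by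
        refine setLIntegral_mono' measurableSet_ball fun x hx => ?_
        refine ENNReal.ofReal_le_ofReal (Real.exp_le_exp.2 ?_)
        have hUx := hU_le x (Metric.ball_subset_ball (div_le_self hρ.le hβ) hx)
        have hdist : β * dist x x₀ ≤ ρ := by
          rw [mul_comm]
          exact (le_div_iff₀ hβ₀).1 (Metric.mem_ball.1 hx).le
        rw [neg_mul, neg_le_neg_iff]
        calc β * U x ≤ β * (K * dist x x₀) := by gcongr
          _ = K * (β * dist x x₀) := by ring
          _ ≤ K * ρ := by gcongr
    _ ≤ _ := setLIntegral_le_lintegral _ _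

end
end

section
/- Let d ≥ 1 and let U : ℝ^d → [0,∞) be a C^∞ function that attains the value 0 at some point of ℝ^d, and suppose ∫_{ℝ^d} e^{−α₀ U(x)} dx < ∞ for some α₀ > 0. Then for every ε > 0, the Gibbs mass of the region {U > ε} vanishes at low temperature: ( ∫_{{x : U(x) > ε}} e^{−β U(x)} dx ) / ( ∫_{ℝ^d} e^{−β U(x)} dx ) → 0 as β → ∞. -/
open MeasureTheory Filter Set
open scoped ENNReal NNReal

noncomputable section

/-- If `U` is measurable, `e^{-α₀ U}` has finite integral and every sublevel set `{U < δ}`, `δ > 0`,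
has positive measure, then the Gibbs mass of `{U > ε}` tends to `0` as `β → ∞`. -/
theorem tendsto_gibbs_mass_superlevel {X : Type*} [MeasurableSpace X] {μ : Measure X} {U : X → ℝ}
    (hU : Measurable U) (hpos : ∀ δ > 0, μ {x | U x < δ} ≠ 0) {α₀ : ℝ}
    (hint : (∫⁻ x, ENNReal.ofReal (Real.exp (-α₀ * U x)) ∂μ) ≠ ⊤) {ε : ℝ} (hε : 0 < ε) :
    Tendsto (fun β : ℝ =>
      (∫⁻ x in {x | ε < U x}, ENNReal.ofReal (Real.exp (-β * U x)) ∂μ) /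
        ∫⁻ x, ENNReal.ofReal (Real.exp (-β * U x)) ∂μ) atTop (nhds 0) := by
  set I := ∫⁻ x, ENNReal.ofReal (Real.exp (-α₀ * U x)) ∂μ
  set m := μ {x | U x < ε / 2}
  have hm : m ≠ 0 := hpos _ (half_pos hε)
  have hC : I / m ≠ ⊤ := ENNReal.div_ne_top hint hm
  have hexp : Tendsto (fun β : ℝ => ENNReal.ofReal (Real.exp (α₀ * ε - β * (ε / 2))))
      atTop (nhds 0) := by
    rw [← ENNReal.ofReal_zero]
    refine ENNReal.tendsto_ofReal (Real.tendsto_exp_atBot.comp ?_)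
    simpa [sub_eq_add_neg] using tendsto_atBot_add_const_left _ (α₀ * ε)
      (tendsto_neg_atTop_atBot.comp (tendsto_id.atTop_mul_const (half_pos hε)))
  have hlim : Tendsto (fun β : ℝ => ENNReal.ofReal (Real.exp (α₀ * ε - β * (ε / 2))) * (I / m))
      atTop (nhds 0) := by
    simpa using ENNReal.Tendsto.mul_const hexp (Or.inr hC)
  refine tendsto_of_tendsto_of_tendsto_of_le_of_le' tendsto_const_nhds hlim
    (Eventually.of_forall fun _ => zero_le) ?_
  filter_upwards [eventually_ge_atTop α₀, eventually_ge_atTop 0] with β hβ hβ0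
  have hnum : (∫⁻ x in {x | ε < U x}, ENNReal.ofReal (Real.exp (-β * U x)) ∂μ) ≤
      ENNReal.ofReal (Real.exp (-(β - α₀) * ε)) * I := by
    rw [← lintegral_const_mul' _ _ ENNReal.ofReal_ne_top]
    refine (setLIntegral_mono' (measurableSet_lt measurable_const hU) fun x hx => ?_).trans
      (setLIntegral_le_lintegral _ _)
    rw [← ENNReal.ofReal_mul (Real.exp_nonneg _), ← Real.exp_add]
    refine ENNReal.ofReal_le_ofReal (Real.exp_le_exp.2 ?_)
    nlinarith [mul_le_mul_of_nonneg_left (le_of_lt hx) (sub_nonneg.2 hβ)]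
  have hden : ENNReal.ofReal (Real.exp (-β * (ε / 2))) * m ≤
      ∫⁻ x, ENNReal.ofReal (Real.exp (-β * U x)) ∂μ := by
    rw [← setLIntegral_const]
    refine (setLIntegral_mono' (measurableSet_lt hU measurable_const) fun x hx => ?_).trans
      (setLIntegral_le_lintegral _ _)
    refine ENNReal.ofReal_le_ofReal (Real.exp_le_exp.2 ?_)
    nlinarith [mul_le_mul_of_nonneg_left (le_of_lt hx) hβ0]
  have hsplit : ENNReal.ofReal (Real.exp (-(β - α₀) * ε)) =
      ENNReal.ofReal (Real.exp (-β * (ε / 2))) *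
        ENNReal.ofReal (Real.exp (α₀ * ε - β * (ε / 2))) := by
    rw [← ENNReal.ofReal_mul (Real.exp_nonneg _), ← Real.exp_add]
    ring_nf
  refine (ENNReal.div_le_div hnum hden).trans_eq ?_
  rw [hsplit, mul_assoc, ENNReal.mul_div_mul_left _ _
    (ENNReal.ofReal_pos.2 (Real.exp_pos _)).ne' ENNReal.ofReal_ne_top, mul_div_assoc]

/-- **Lemma.** If `U : ℝ^d → [0,∞)` is `C^∞`, attains the value `0`, and
`∫ e^{-α₀ U} dx < ∞` for some `α₀ > 0`, then for every `ε > 0` the Gibbs mass of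
`{U > ε}` vanishes at low temperature:
`(∫_{U > ε} e^{-βU} dx) / (∫_{ℝ^d} e^{-βU} dx) → 0` as `β → ∞`. -/
theorem gibbs_concentration
    {d : ℕ} (hd : 1 ≤ d) (U : Euc d → ℝ) (hU : ContDiff ℝ (⊤ : ℕ∞) U)
    (hUnonneg : ∀ x, 0 ≤ U x) (hU0 : ∃ x, U x = 0)
    (α₀ : ℝ) (hα₀ : 0 < α₀)
    (hint : (∫⁻ x, ENNReal.ofReal (Real.exp (-α₀ * U x))
      ∂(MeasureTheory.volume : MeasureTheory.Measure (Euc d))) < ⊤) :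
    ∀ ε > (0 : ℝ),
      Filter.Tendsto
        (fun β : ℝ =>
          (∫⁻ x in {x | ε < U x}, ENNReal.ofReal (Real.exp (-β * U x))
            ∂(MeasureTheory.volume : MeasureTheory.Measure (Euc d))) /
          ∫⁻ x, ENNReal.ofReal (Real.exp (-β * U x))
            ∂(MeasureTheory.volume : MeasureTheory.Measure (Euc d)))
        Filter.atTop (nhds 0) := by
  intro ε hε
  obtain ⟨x₀, hx₀⟩ := hU0
  refine tendsto_gibbs_mass_superlevel hU.continuous.measurable (fun δ hδ => ?_) hint.ne hε
  exact ((isOpen_lt hU.continuous continuous_const).measure_pos _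
    ⟨x₀, by simpa [hx₀] using hδ⟩).ne'

end
end
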